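/- Let X be a Hausdorff topological space and μ a locally finite Borel measure on X with full support, V a nonzero finite-dimensional complex inner product space, and (T_t)_{t>0} a semigroup of integral operators: for each t > 0, T_t is the integral operator with continuous kernel k(t,·,·) : X × X → End(V) satisfying sup_{x,y} ‖k(t,x,y)‖ < ∞, with T_{s+t} = T_s ∘ T_t; assume that (T_t) extends to a strongly continuous semigroup of bounded operators on L¹(X,μ;V), that ‖T_1‖_{1→∞} < ∞, and that for every t > 0 and every f ∈ L¹(X,μ;V) ∩ L²(X,μ;V), ⟨f, T_t f⟩_{L²} is a nonnegative real number. Assume moreover that k(t,x,x) is not identically zero for each t > 0. Then liminf_{t→∞} 2 log ‖T_t‖_{1→∞} / log(1/t) = liminf_{t→∞} ( -2 log( sup_{x∈X} Tr(k(t,x,x)) ) / log t ), the equality holding in [-∞,∞]. -/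

import Mathlib

open Filter MeasureTheory Set Topology ENNReal

set_option linter.unusedSectionVars false

namespace AsympDim

variable {X : Type*} [TopologicalSpace X] [MeasurableSpace X] [BorelSpace X]
    {μ : Measure X}
    {V : Type*} [NormedAddCommGroup V] [InnerProductSpace ℂ V] [FiniteDimensional ℂ V]

/-- normalized bump -/
noncomputable def bump (μ : Measure X) (U : Set X) (v : V) : X → V :=
  U.indicator fun _ => (μ.real U)⁻¹ • v

lemma bump_memLp {U : Set X} (hU : IsOpen U) (hf : μ U ≠ ⊤) (v : V) (p : ℝ≥0∞) :
    MemLp (bump μ U v) p μ :=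
  memLp_indicator_const p hU.measurableSet _ (Or.inr hf)

lemma integral_bump {U : Set X} (hU : IsOpen U) (L : X → V →L[ℂ] V) (v : V) :
    ∫ y, L y (bump μ U v y) ∂μ = ⨍ y in U, L y v ∂μ := by
  rw [setAverage_eq, ← integral_smul, ← integral_indicator hU.measurableSet]
  congr 1
  ext y
  by_cases hy : y ∈ U
  · simp only [bump, Set.indicator_of_mem hy]
    exact (L y).map_smul_of_tower _ v
  · simp [bump, Set.indicator_of_notMem hy]

lemma integral_inner_bump {U : Set X} (hU : IsOpen U) (g : X → V) (v : V) :
    ∫ x, inner ℂ (bump μ U v x) (g x) ∂μ = ⨍ x in U, inner ℂ v (g x) ∂μ := by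
  rw [setAverage_eq, ← integral_smul, ← integral_indicator hU.measurableSet]
  congr 1
  ext y
  by_cases hy : y ∈ U
  · simp only [bump, Set.indicator_of_mem hy]
    rw [← Complex.coe_smul, ← Complex.coe_smul, inner_smul_left, Complex.conj_ofReal, smul_eq_mul]
  · simp [bump, Set.indicator_of_notMem hy]

lemma integrable_apply {L : X → V →L[ℂ] V} (hL : Continuous L) {M : ℝ}
    (hM : ∀ y, ‖L y‖ ≤ M) {f : X → V} (hf : Integrable f μ) :
    Integrable (fun y => L y (f y)) μ := by
  have : ProperSpace (V →L[ℂ] V) := FiniteDimensional.proper ℂ _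
  have h1 : AEStronglyMeasurable L μ := hL.aestronglyMeasurable
  have h2 := (ContinuousLinearMap.id ℂ (V →L[ℂ] V)).aestronglyMeasurable_comp₂
    h1 hf.aestronglyMeasurable
  refine (hf.norm.const_mul M).mono' h2 (ae_of_all _ fun y => ?_)
  exact (L y).le_of_opNorm_le (hM y) (f y)

lemma exists_nhd [IsLocallyFiniteMeasure μ] [μ.IsOpenPosMeasure] (x : X) {s : Set X}
    (hs : s ∈ 𝓝 x) :
    ∃ U ⊆ s, IsOpen U ∧ x ∈ U ∧ μ U ≠ 0 ∧ μ U ≠ ⊤ := by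
  obtain ⟨O, hxO, hO, hfin⟩ := μ.exists_isOpen_measure_lt_top x
  obtain ⟨W, hWs, hW, hxW⟩ := mem_nhds_iff.1 hs
  refine ⟨W ∩ O, fun y hy => hWs hy.1, hW.inter hO, ⟨hxW, hxO⟩, ?_, ?_⟩
  · exact (hW.inter hO).measure_ne_zero μ ⟨x, hxW, hxO⟩
  · exact ((measure_mono inter_subset_right).trans_lt hfin).ne

/-- inner average lies close to value -/
lemma avg_mem {W : Set X} (hW : IsOpen W) (h0 : μ W ≠ 0) (hf : μ W ≠ ⊤)
    {L : X → V →L[ℂ] V} (hL : Continuous L) {M : ℝ}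
    (hM : ∀ y, ‖L y‖ ≤ M) (w c : V) {ε : ℝ} (h : ∀ y ∈ W, L y w ∈ Metric.closedBall c ε) :
    ∫ y, L y (bump μ W w y) ∂μ ∈ Metric.closedBall c ε := by
  have : CompleteSpace V := FiniteDimensional.complete ℂ V
  rw [integral_bump hW]
  refine Convex.set_average_mem (convex_closedBall c ε) Metric.isClosed_closedBall h0 hf
    (ae_restrict_of_forall_mem hW.measurableSet h) ?_
  have : IsFiniteMeasure (μ.restrict W) := ⟨by simpa using hf.lt_top⟩
  exact integrable_apply hL hM (integrable_const w)

/-- The bilinear form. -/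
noncomputable def B (μ : Measure X) (κ : X × X → V →L[ℂ] V) (f g : X → V) : ℂ :=
  ∫ x, (inner ℂ (f x) (∫ y, κ (x, y) (g y) ∂μ) : ℂ) ∂μ

lemma integrable_inner_bump {U : Set X} (hU : IsOpen U) (v : V)
    {g : X → V} (hg : Integrable g μ) :
    Integrable (fun x => (inner ℂ (bump μ U v x) (g x) : ℂ)) μ := by
  have h : (fun x => (inner ℂ (bump μ U v x) (g x) : ℂ)) =
      U.indicator fun x => (inner ℂ ((μ.real U)⁻¹ • v) (g x) : ℂ) := by
    ext x
    by_cases hx : x ∈ U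
    · simp [bump, Set.indicator_of_mem hx]
    · simp [bump, Set.indicator_of_notMem hx]
  rw [h]
  exact (hg.const_inner _).indicator hU.measurableSet

lemma B_mem {κ : X × X → V →L[ℂ] V} (hκ : Continuous κ) {M : ℝ} (hM : ∀ p, ‖κ p‖ ≤ M)
    (H : ∀ f : X → V, Integrable f μ → Integrable (fun x => ∫ y, κ (x, y) (f y) ∂μ) μ)
    {U W : Set X} (hU : IsOpen U) (hU0 : μ U ≠ 0) (hUf : μ U ≠ ⊤)
    (hW : IsOpen W) (hW0 : μ W ≠ 0) (hWf : μ W ≠ ⊤) (v w c : V) {ε : ℝ}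
    (h : ∀ x ∈ U, ∀ y ∈ W, κ (x, y) w ∈ Metric.closedBall c ε) :
    B μ κ (bump μ U v) (bump μ W w) ∈ Metric.closedBall (inner ℂ v c) (‖v‖ * ε) := by
  unfold B
  rw [integral_inner_bump hU]
  refine Convex.set_average_mem (convex_closedBall _ _) Metric.isClosed_closedBall hU0 hUf
    (ae_restrict_of_forall_mem hU.measurableSet fun x hx => ?_) ?_
  · have := avg_mem (μ := μ) hW hW0 hWf (L := fun y => κ (x, y)) (by fun_prop)
      (fun y => hM (x, y)) w c (h x hx)
    rw [Metric.mem_closedBall, dist_eq_norm] at this ⊢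
    rw [← inner_sub_right]
    exact (norm_inner_le_norm _ _).trans (by gcongr)
  · exact ((H _ (memLp_one_iff_integrable.1 (bump_memLp hW hWf w 1))).const_inner v).integrableOn

lemma B_add {κ : X × X → V →L[ℂ] V} (hκ : Continuous κ) {M : ℝ} (hM : ∀ p, ‖κ p‖ ≤ M)
    (H : ∀ f : X → V, Integrable f μ → Integrable (fun x => ∫ y, κ (x, y) (f y) ∂μ) μ)
    {U W : Set X} (hU : IsOpen U) (hUf : μ U ≠ ⊤)
    (hW : IsOpen W) (hWf : μ W ≠ ⊤) (v w : V) :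
    B μ κ (bump μ U v + bump μ W w) (bump μ U v + bump μ W w) =
      B μ κ (bump μ U v) (bump μ U v) + B μ κ (bump μ U v) (bump μ W w) +
      (B μ κ (bump μ W w) (bump μ U v) + B μ κ (bump μ W w) (bump μ W w)) := by
  have iU := memLp_one_iff_integrable.1 (bump_memLp (μ := μ) hU hUf v 1)
  have iW := memLp_one_iff_integrable.1 (bump_memLp (μ := μ) hW hWf w 1)
  have e : ∀ x, ∫ y, κ (x, y) ((bump μ U v + bump μ W w) y) ∂μ =
      ∫ y, κ (x, y) (bump μ U v y) ∂μ + ∫ y, κ (x, y) (bump μ W w y) ∂μ := fun x => by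
    simp only [Pi.add_apply, map_add]
    exact integral_add (integrable_apply (by fun_prop) (fun y => hM (x, y)) iU)
      (integrable_apply (by fun_prop) (fun y => hM (x, y)) iW)
  unfold B
  simp_rw [e]
  simp only [Pi.add_apply, inner_add_left, inner_add_right]
  have a := integrable_inner_bump hU v (H _ iU)
  have b := integrable_inner_bump hU v (H _ iW)
  have c := integrable_inner_bump hW w (H _ iU)
  have d := integrable_inner_bump hW w (H _ iW)
  rw [← integral_add a b, ← integral_add c d]
  refine Eq.trans ?_ (integral_add (a.add b) (c.add d))
  congr 1
  ext x
  ring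

lemma block_pos [IsLocallyFiniteMeasure μ] [μ.IsOpenPosMeasure]
    {κ : X × X → V →L[ℂ] V} (hκ : Continuous κ) {M : ℝ} (hM : ∀ p, ‖κ p‖ ≤ M)
    (H : ∀ f : X → V, Integrable f μ → Integrable (fun x => ∫ y, κ (x, y) (f y) ∂μ) μ)
    (hpos : ∀ f : X → V, MemLp f 1 μ → MemLp f 2 μ → 0 ≤ (B μ κ f f).re ∧ (B μ κ f f).im = 0)
    (x y : X) (v w : V) :
    let Q : ℂ := inner ℂ v (κ (x, x) v) + inner ℂ v (κ (x, y) w) +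
      (inner ℂ w (κ (y, x) v) + inner ℂ w (κ (y, y) w))
    0 ≤ Q.re ∧ Q.im = 0 := by
  intro Q
  have hcl : IsClosed {z : ℂ | 0 ≤ z.re ∧ z.im = 0} :=
    (isClosed_le continuous_const Complex.continuous_re).inter
      (isClosed_eq Complex.continuous_im continuous_const)
  change Q ∈ {z : ℂ | 0 ≤ z.re ∧ z.im = 0}
  rw [← hcl.closure_eq, Metric.mem_closure_iff]
  intro δ hδ
  set D : ℝ := 2 * ‖v‖ + 2 * ‖w‖ + 1 with hD
  have hDpos : 0 < D := by positivity
  set ε : ℝ := δ / D with hε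
  have hεpos : 0 < ε := by positivity
  have nb : ∀ (a b : X) (u : V), ∃ S ∈ 𝓝 a, ∃ R ∈ 𝓝 b, ∀ a' ∈ S, ∀ b' ∈ R,
      κ (a', b') u ∈ Metric.closedBall (κ (a, b) u) ε := by
    intro a b u
    have hc : Continuous fun p : X × X => κ p u := by fun_prop
    have := hc.continuousAt (x := (a, b)) (Metric.closedBall_mem_nhds _ hεpos)
    rw [nhds_prod_eq, Filter.mem_map, Filter.mem_prod_iff] at this
    obtain ⟨S, hS, R, hR, h⟩ := this
    exact ⟨S, hS, R, hR, fun a' ha b' hb => h ⟨ha, hb⟩⟩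
  obtain ⟨S1, hS1, R1, hR1, h1⟩ := nb x x v
  obtain ⟨S2, hS2, R2, hR2, h2⟩ := nb x y w
  obtain ⟨S3, hS3, R3, hR3, h3⟩ := nb y x v
  obtain ⟨S4, hS4, R4, hR4, h4⟩ := nb y y w
  obtain ⟨U, hUs, hU, -, hU0, hUf⟩ := exists_nhd (μ := μ) x
    (inter_mem (inter_mem hS1 hR1) (inter_mem hS2 hR3))
  obtain ⟨W, hWs, hW, -, hW0, hWf⟩ := exists_nhd (μ := μ) y
    (inter_mem (inter_mem hS4 hR4) (inter_mem hS3 hR2))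
  have m1 := B_mem hκ hM H hU hU0 hUf hU hU0 hUf v v (κ (x, x) v) (ε := ε)
    fun a ha b hb => h1 a (hUs ha).1.1 b (hUs hb).1.2
  have m2 := B_mem hκ hM H hU hU0 hUf hW hW0 hWf v w (κ (x, y) w) (ε := ε)
    fun a ha b hb => h2 a (hUs ha).2.1 b (hWs hb).2.2
  have m3 := B_mem hκ hM H hW hW0 hWf hU hU0 hUf w v (κ (y, x) v) (ε := ε)
    fun a ha b hb => h3 a (hWs ha).2.1 b (hUs hb).2.2
  have m4 := B_mem hκ hM H hW hW0 hWf hW hW0 hWf w w (κ (y, y) w) (ε := ε)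
    fun a ha b hb => h4 a (hWs ha).1.1 b (hWs hb).1.2
  refine ⟨_, hpos (bump μ U v + bump μ W w)
    ((bump_memLp hU hUf v 1).add (bump_memLp hW hWf w 1))
    ((bump_memLp hU hUf v 2).add (bump_memLp hW hWf w 2)), ?_⟩
  rw [B_add hκ hM H hU hUf hW hWf, dist_comm]
  rw [Metric.mem_closedBall] at m1 m2 m3 m4
  have t1 := dist_add_add_le_of_le m1 m2
  have t2 := dist_add_add_le_of_le m3 m4
  refine (dist_add_add_le_of_le t1 t2).trans_lt ?_
  have : ε * D = δ := div_mul_cancel₀ _ hDpos.ne'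
  rw [hD] at this
  linarith

/-- Abstract positivity of two-point blocks. -/
def BlockPos (κ : X × X → V →L[ℂ] V) : Prop := ∀ (x y : X) (v w : V),
    0 ≤ (inner ℂ v (κ (x, x) v) + inner ℂ v (κ (x, y) w) +
      (inner ℂ w (κ (y, x) v) + inner ℂ w (κ (y, y) w)) : ℂ).re ∧
    (inner ℂ v (κ (x, x) v) + inner ℂ v (κ (x, y) w) +
      (inner ℂ w (κ (y, x) v) + inner ℂ w (κ (y, y) w)) : ℂ).im = 0

lemma BlockPos.diag {κ : X × X → V →L[ℂ] V} (h : BlockPos κ) (x : X) (v : V) :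
    0 ≤ (inner ℂ v (κ (x, x) v) : ℂ).re ∧ (inner ℂ v (κ (x, x) v) : ℂ).im = 0 := by
  simpa using h x x v 0

lemma BlockPos.le_trace {κ : X × X → V →L[ℂ] V} (h : BlockPos κ) (x : X) (v : V)
    (hv : ‖v‖ = 1) :
    (inner ℂ v (κ (x, x) v) : ℂ).re ≤
      (LinearMap.trace ℂ V (κ (x, x) : V →ₗ[ℂ] V)).re := by
  have ho : Orthonormal ℂ (Subtype.val : ({v} : Set V) → V) := by
    refine ⟨fun i => ?_, fun i j hij => absurd (Subsingleton.elim i j) hij⟩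
    rw [show (i : V) = v from i.2]; exact hv
  obtain ⟨u, b, hu, hb⟩ := ho.exists_orthonormalBasis_extension
  rw [LinearMap.trace_eq_sum_inner _ b, Complex.re_sum]
  have hvu : v ∈ u := hu rfl
  have := Finset.single_le_sum (s := Finset.univ)
    (f := fun i => (inner ℂ (b i) ((κ (x, x) : V →ₗ[ℂ] V) (b i)) : ℂ).re)
    (fun i _ => (h.diag x (b i)).1) (Finset.mem_univ (⟨v, hvu⟩ : u))
  simpa [hb] using this

lemma BlockPos.norm_le {κ : X × X → V →L[ℂ] V} (h : BlockPos κ) {S : ℝ}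
    (hS : ∀ x, (LinearMap.trace ℂ V (κ (x, x) : V →ₗ[ℂ] V)).re ≤ S) (hS0 : 0 ≤ S)
    (x y : X) : ‖κ (x, y)‖ ≤ S := by
  have key : ∀ v w : V, ‖v‖ = 1 → ‖w‖ = 1 → ‖(inner ℂ v (κ (x, y) w) : ℂ)‖ ≤ S := by
    intro v w hv hw
    set p : ℂ := inner ℂ v (κ (x, y) w) with hp
    set q : ℂ := inner ℂ w (κ (y, x) v) with hq
    have ha := (h.le_trace x v hv).trans (hS x)
    have hb := (h.le_trace y w hw).trans (hS y)
    have ia := (h.diag x v).2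
    have ib := (h.diag y w).2
    have hc : ∀ c : ℂ, ‖c‖ = 1 → 0 ≤ 2 * S + (c * p + (starRingEnd ℂ) c * q).re ∧
        (c * p + (starRingEnd ℂ) c * q).im = 0 := by
      intro c hc
      have hh := h x y v (c • w)
      have hbb := (h.le_trace y (c • w) (by rw [norm_smul, hc, hw, one_mul])).trans (hS y)
      have ibb := (h.diag y (c • w)).2
      have e1 : (inner ℂ v (κ (x, y) (c • w)) : ℂ) = c * p := by
        rw [map_smul, inner_smul_right]
      have e2 : (inner ℂ (c • w) (κ (y, x) v) : ℂ) = (starRingEnd ℂ) c * q := by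
        rw [inner_smul_left]
      rw [e1, e2] at hh
      simp only [Complex.add_re, Complex.add_im] at hh ⊢
      constructor
      · linarith [hh.1]
      · linarith [hh.2]
    have c1 := (hc 1 (by simp)).2
    have c2 := (hc Complex.I (by simp)).2
    simp at c1 c2
    have hqp : q = (starRingEnd ℂ) p := by
      apply Complex.ext
      · simp; linarith
      · simp; linarith
    by_cases hp0 : p = 0
    · rw [hp0]; simpa using hS0
    have hn : (‖p‖ : ℝ) ≠ 0 := by simpa using hp0
    have c3 := (hc (-(starRingEnd ℂ) p / ‖p‖) (by
      rw [norm_div, norm_neg, RCLike.norm_conj, Complex.norm_real, norm_norm, div_self hn])).1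
    have hpp : (starRingEnd ℂ) p * p = ((‖p‖ ^ 2 : ℝ) : ℂ) := by
      rw [mul_comm, Complex.mul_conj, Complex.normSq_eq_norm_sq]
    have hx : -(starRingEnd ℂ) p / ‖p‖ * p = ((-‖p‖ : ℝ) : ℂ) := by
      rw [div_mul_eq_mul_div, neg_mul, hpp]
      push_cast
      have : (‖p‖ : ℂ) ≠ 0 := by exact_mod_cast hn
      field_simp
    have hy : (starRingEnd ℂ) (-(starRingEnd ℂ) p / ‖p‖) * q = ((-‖p‖ : ℝ) : ℂ) := by
      rw [hqp, ← map_mul, hx, Complex.conj_ofReal]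
    rw [hx, hy, ← Complex.ofReal_add, Complex.ofReal_re] at c3
    linarith
  refine ContinuousLinearMap.opNorm_le_of_unit_norm hS0 fun w hw => ?_
  by_cases hz : κ (x, y) w = 0
  · rw [hz]; simpa using hS0
  have hn : ‖κ (x, y) w‖ ≠ 0 := by simpa using hz
  have := key (((‖κ (x, y) w‖⁻¹ : ℝ) : ℂ) • κ (x, y) w) w
    (by rw [norm_smul, Complex.norm_real, norm_inv, norm_norm, inv_mul_cancel₀ hn]) hw
  rw [inner_smul_left, inner_self_eq_norm_sq_to_K, norm_mul, RCLike.norm_conj,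
    Complex.norm_real, norm_inv, norm_norm, norm_pow] at this
  simp only [Complex.coe_algebraMap, Complex.norm_real, norm_norm] at this
  rwa [pow_two, ← mul_assoc, inv_mul_cancel₀ hn, one_mul] at this

lemma liminf_le_of_close {u v : ℝ → ℝ}
    (h : Tendsto (fun t => u t - v t) atTop (𝓝 0)) :
    liminf (fun t => (u t : EReal)) atTop ≤ liminf (fun t => (v t : EReal)) atTop := by
  refine le_of_forall_lt fun a ha => ?_
  obtain ⟨c, hac, hc⟩ := EReal.lt_iff_exists_real_btwn.1 ha
  obtain ⟨b, hcb, hb⟩ := EReal.lt_iff_exists_real_btwn.1 hc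
  have hcb' : 0 < b - c := sub_pos.2 (EReal.coe_lt_coe_iff.1 hcb)
  refine hac.trans_le (le_liminf_of_le (by isBoundedDefault) ?_)
  filter_upwards [eventually_lt_of_lt_liminf hb, h.eventually_lt_const hcb'] with t h1 h2
  have := EReal.coe_lt_coe_iff.1 h1
  exact EReal.coe_le_coe_iff.2 (by linarith)

lemma norm_bump_le {U : Set X} (hU : IsOpen U) (hU0 : μ U ≠ 0) (hUf : μ U ≠ ⊤) (v : V)
    (hv : ‖v‖ = 1) : ∫ x, ‖bump μ U v x‖ ∂μ = 1 := by
  have hr : μ.real U ≠ 0 := by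
    rw [Measure.real, ENNReal.toReal_ne_zero]; exact ⟨hU0, hUf⟩
  have : (fun x => ‖bump μ U v x‖) = U.indicator fun _ => (μ.real U)⁻¹ := by
    ext x
    by_cases hx : x ∈ U
    · simp [bump, Set.indicator_of_mem hx, norm_smul, hv]
    · simp [bump, Set.indicator_of_notMem hx]
  rw [this, integral_indicator hU.measurableSet, setIntegral_const, smul_eq_mul,
    mul_inv_cancel₀ hr]

lemma norm_apply_le [IsLocallyFiniteMeasure μ] [μ.IsOpenPosMeasure]
    {κ : X × X → V →L[ℂ] V} (hκ : Continuous κ) {M : ℝ} (hM : ∀ p, ‖κ p‖ ≤ M)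
    (A : Lp V 1 μ → Lp V 1 μ)
    (hA : ∀ f : Lp V 1 μ, ∀ᵐ x ∂μ, (A f : X → V) x = ∫ y, κ (x, y) (f y) ∂μ)
    {n : ℝ≥0∞} (hn : n ≠ ⊤) (hnA : ∀ f : Lp V 1 μ, ‖f‖ ≤ 1 → eLpNorm (A f) ⊤ μ ≤ n)
    (x : X) (v : V) (hv : ‖v‖ = 1) : ‖κ (x, x) v‖ ≤ n.toReal := by
  refine le_of_forall_pos_le_add fun ε hε => ?_
  have hc : Continuous fun p : X × X => κ p v := by fun_prop
  have := hc.continuousAt (x := (x, x)) (Metric.closedBall_mem_nhds _ hε)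
  rw [nhds_prod_eq, Filter.mem_map, Filter.mem_prod_iff] at this
  obtain ⟨S, hS, R, hR, h⟩ := this
  obtain ⟨U, hUs, hU, -, hU0, hUf⟩ := exists_nhd (μ := μ) x (inter_mem hS hR)
  have iU := memLp_one_iff_integrable.1 (bump_memLp (μ := μ) hU hUf v 1)
  set f : Lp V 1 μ := iU.toL1 _ with hf
  have hf1 : ‖f‖ ≤ 1 := by
    rw [hf, L1.norm_of_fun_eq_integral_norm, norm_bump_le hU hU0 hUf v hv]
  have hle := hnA f hf1
  rw [eLpNorm_exponent_top] at hle
  have hae : ∀ᵐ z ∂μ, ‖(A f : X → V) z‖ₑ ≤ n ∧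
      (A f : X → V) z = ∫ y, κ (z, y) (f y) ∂μ := by
    filter_upwards [ae_le_eLpNormEssSup (f := (A f : X → V)) (μ := μ), hA f] with z h1 h2
    exact ⟨h1.trans hle, h2⟩
  obtain ⟨z, hzU, hz1, hz2⟩ : ∃ z ∈ U, ‖(A f : X → V) z‖ₑ ≤ n ∧
      (A f : X → V) z = ∫ y, κ (z, y) (f y) ∂μ := by
    by_contra hcon
    push Not at hcon
    refine hU0 (measure_mono_null (fun z hz => ?_) (ae_iff.1 hae))
    exact fun hh => hcon z hz hh.1 hh.2
  have e : ∫ y, κ (z, y) (f y) ∂μ = ∫ y, κ (z, y) (bump μ U v y) ∂μ := by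
    refine integral_congr_ae ?_
    filter_upwards [iU.coeFn_toL1] with y hy
    rw [hf, hy]
  have hm := avg_mem (μ := μ) hU hU0 hUf (L := fun y => κ (z, y)) (by fun_prop)
      (fun y => hM (z, y)) v (κ (x, x) v) (ε := ε)
      (fun y hy => h (a := (z, y)) ⟨(hUs hzU).1, (hUs hy).2⟩)
  rw [← e, ← hz2, Metric.mem_closedBall, dist_comm, dist_eq_norm] at hm
  have h3 : ‖(A f : X → V) z‖ ≤ n.toReal := by
    have := ENNReal.toReal_mono hn hz1
    simpa using this
  have := norm_le_norm_add_norm_sub ((A f : X → V) z) (κ (x, x) v)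
  rw [norm_sub_rev] at this
  linarith

lemma upper {κ : X × X → V →L[ℂ] V} {M : ℝ} (hM : ∀ p, ‖κ p‖ ≤ M) (hM0 : 0 ≤ M)
    (A : Lp V 1 μ → Lp V 1 μ)
    (hA : ∀ f : Lp V 1 μ, ∀ᵐ x ∂μ, (A f : X → V) x = ∫ y, κ (x, y) (f y) ∂μ)
    (f : Lp V 1 μ) (hf : ‖f‖ ≤ 1) : eLpNorm (A f) ⊤ μ ≤ ENNReal.ofReal M := by
  rw [eLpNorm_exponent_top]
  refine eLpNormEssSup_le_of_ae_bound ?_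
  filter_upwards [hA f] with x hx
  rw [hx]
  have hi : Integrable (fun y => M * ‖f y‖) μ := (L1.integrable_coeFn f).norm.const_mul M
  refine (norm_integral_le_of_norm_le hi
    (ae_of_all _ fun y => (κ (x, y)).le_of_opNorm_le (hM _) _)).trans ?_
  rw [integral_const_mul, ← L1.norm_eq_integral_norm]
  exact mul_le_of_le_one_right hM0 hf

lemma comparison [IsLocallyFiniteMeasure μ] [μ.IsOpenPosMeasure]
    {κ : X × X → V →L[ℂ] V} (hκ : Continuous κ)
    (hbdd : BddAbove (Set.range fun p : X × X => ‖κ p‖))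
    (A : Lp V 1 μ → Lp V 1 μ)
    (hA : ∀ f : Lp V 1 μ, ∀ᵐ x ∂μ, (A f : X → V) x = ∫ y, κ (x, y) (f y) ∂μ)
    (hpos : ∀ f : X → V, MemLp f 1 μ → MemLp f 2 μ → 0 ≤ (B μ κ f f).re ∧ (B μ κ f f).im = 0)
    (hnz : ∃ x, κ (x, x) ≠ 0) {n : ℝ≥0∞}
    (hn : n = ⨆ f : {f : Lp V 1 μ // ‖f‖ ≤ 1}, eLpNorm (A f.1) ⊤ μ) :
    let S : ℝ := ⨆ x : X, (LinearMap.trace ℂ V (κ (x, x) : V →ₗ[ℂ] V)).re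
    0 < S ∧ n.toReal ≤ S ∧ S ≤ Module.finrank ℂ V * n.toReal := by
  intro S
  obtain ⟨x0, hx0⟩ := hnz
  have : Nonempty X := ⟨x0⟩
  obtain ⟨M, hM'⟩ := hbdd
  have hM : ∀ p, ‖κ p‖ ≤ M := fun p => hM' ⟨p, rfl⟩
  have hM0 : 0 ≤ M := (norm_nonneg _).trans (hM (x0, x0))
  have H : ∀ f : X → V, Integrable f μ →
      Integrable (fun x => ∫ y, κ (x, y) (f y) ∂μ) μ := by
    intro f hf
    refine (L1.integrable_coeFn (A (hf.toL1 f))).congr ?_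
    filter_upwards [hA (hf.toL1 f)] with x hx
    rw [hx]
    refine integral_congr_ae ?_
    filter_upwards [hf.coeFn_toL1] with y hy
    rw [hy]
  have hB : BlockPos κ := fun x y v w => block_pos hκ hM H hpos x y v w
  have hnt : n ≠ ⊤ := by
    have hle : n ≤ ENNReal.ofReal M := by
      rw [hn]
      exact iSup_le fun f => upper hM hM0 A hA f.1 f.2
    exact ne_top_of_le_ne_top ENNReal.ofReal_ne_top hle
  have hnA : ∀ f : Lp V 1 μ, ‖f‖ ≤ 1 → eLpNorm (A f) ⊤ μ ≤ n := by
    intro f hf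
    rw [hn]
    exact le_iSup (fun f : {f : Lp V 1 μ // ‖f‖ ≤ 1} => eLpNorm (A f.1) ⊤ μ) ⟨f, hf⟩
  have hlow := norm_apply_le hκ hM A hA hnt hnA
  have htr : ∀ x, (LinearMap.trace ℂ V (κ (x, x) : V →ₗ[ℂ] V)).re ≤
      Module.finrank ℂ V * n.toReal := by
    intro x
    rw [LinearMap.trace_eq_sum_inner _ (stdOrthonormalBasis ℂ V), Complex.re_sum]
    refine (Finset.sum_le_card_nsmul _ _ n.toReal fun i _ => ?_).trans (by simp)
    refine (Complex.re_le_norm _).trans ((norm_inner_le_norm _ _).trans ?_)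
    have h1 : ‖stdOrthonormalBasis ℂ V i‖ = 1 := (stdOrthonormalBasis ℂ V).norm_eq_one i
    rw [h1, one_mul]
    exact hlow x _ h1
  have hbd : BddAbove (Set.range fun x =>
      (LinearMap.trace ℂ V (κ (x, x) : V →ₗ[ℂ] V)).re) :=
    ⟨_, by rintro _ ⟨x, rfl⟩; exact htr x⟩
  have hle : ∀ x, (LinearMap.trace ℂ V (κ (x, x) : V →ₗ[ℂ] V)).re ≤ S := le_ciSup hbd
  have hS0 : 0 ≤ S := by
    refine le_trans ?_ (hle x0)
    rw [LinearMap.trace_eq_sum_inner _ (stdOrthonormalBasis ℂ V), Complex.re_sum]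
    exact Finset.sum_nonneg fun i _ => (hB.diag x0 _).1
  have hnorm := fun x y => hB.norm_le hle hS0 x y
  refine ⟨(norm_pos_iff.2 hx0).trans_le (hnorm x0 x0), ?_, ciSup_le htr⟩
  refine ENNReal.toReal_le_of_le_ofReal hS0 ?_
  rw [hn]
  exact iSup_le fun f => upper (fun p => hnorm p.1 p.2) hS0 A hA f.1 f.2

end AsympDim

open AsympDim

/-- For a positive semigroup of integral operators with continuous bounded kernels, the
asymptotic dimension `liminf 2 log‖T_t‖_{1→∞}/log(1/t)` equals
`liminf (-2 log(sup_x Tr k(t,x,x)))/log t`, in `[-∞,∞]`. -/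
theorem asymptotic_dimension_eq_liminf_trace_kernel
    {X : Type*} [TopologicalSpace X] [T2Space X] [MeasurableSpace X] [BorelSpace X]
    (μ : Measure X) [IsLocallyFiniteMeasure μ] [μ.IsOpenPosMeasure]
    {V : Type*} [NormedAddCommGroup V] [InnerProductSpace ℂ V] [FiniteDimensional ℂ V]
    [Nontrivial V]
    (k : ℝ → X × X → V →L[ℂ] V)
    (T : ℝ → Lp V 1 μ →L[ℂ] Lp V 1 μ)
    (hkcont : ∀ t : ℝ, 0 < t → Continuous (k t))
    (hkbdd : ∀ t : ℝ, 0 < t → BddAbove (Set.range fun p : X × X => ‖k t p‖))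
    (hker : ∀ t : ℝ, 0 < t → ∀ f : Lp V 1 μ,
      ∀ᵐ x ∂μ, (T t f : X → V) x = ∫ y, k t (x, y) (f y) ∂μ)
    (hT0 : T 0 = ContinuousLinearMap.id ℂ (Lp V 1 μ))
    (hTadd : ∀ s t : ℝ, 0 ≤ s → 0 ≤ t → T (s + t) = (T s).comp (T t))
    (hTcont : ∀ f : Lp V 1 μ, ContinuousOn (fun t => T t f) (Set.Ici (0:ℝ)))
    (N : ℝ → ℝ≥0∞)
    (hN : ∀ t : ℝ, N t = ⨆ f : {f : Lp V 1 μ // ‖f‖ ≤ 1}, eLpNorm (T t f.1) ⊤ μ)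
    (hN1 : N 1 < ⊤)
    (hpos : ∀ t : ℝ, 0 < t → ∀ f : X → V, MemLp f 1 μ → MemLp f 2 μ →
      0 ≤ (∫ x, (inner ℂ (f x) (∫ y, k t (x, y) (f y) ∂μ) : ℂ) ∂μ).re ∧
        (∫ x, (inner ℂ (f x) (∫ y, k t (x, y) (f y) ∂μ) : ℂ) ∂μ).im = 0)
    (hnz : ∀ t : ℝ, 0 < t → ∃ x : X, k t (x, x) ≠ 0) :
    Filter.liminf
        (fun t : ℝ =>
          ((2 * Real.log ((N t).toReal) / Real.log (1 / t) : ℝ) : EReal))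
        Filter.atTop =
      Filter.liminf
        (fun t : ℝ =>
          ((-2 * Real.log (⨆ x : X,
              (LinearMap.trace ℂ V (k t (x, x) : V →ₗ[ℂ] V)).re) / Real.log t : ℝ) : EReal))
        Filter.atTop := by
  have hcmp := fun (t : ℝ) (ht : 0 < t) => comparison (hkcont t ht) (hkbdd t ht) (T t)
    (hker t ht) (hpos t ht) (hnz t ht) (hN t)
  set S : ℝ → ℝ := fun t => ⨆ x : X,
    (LinearMap.trace ℂ V (k t (x, x) : V →ₗ[ℂ] V)).re with hS
  have hd : (0 : ℝ) < Module.finrank ℂ V := by exact_mod_cast Module.finrank_pos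
  have hlim : Tendsto (fun t : ℝ => 2 * Real.log ((N t).toReal) / Real.log (1 / t) -
      -2 * Real.log (S t) / Real.log t) atTop (𝓝 0) := by
    have h0 : Tendsto (fun t : ℝ => 2 * Real.log (Module.finrank ℂ V) / Real.log t) atTop (𝓝 0) :=
      Real.tendsto_log_atTop.const_div_atTop _
    refine squeeze_zero' ?_ ?_ h0
    all_goals
      filter_upwards [eventually_gt_atTop 1] with t ht
      obtain ⟨h1, h2, h3⟩ := hcmp t (by linarith)
      change 0 < S t at h1
      change _ ≤ S t at h2
      change S t ≤ _ at h3
      have hl : 0 < Real.log t := Real.log_pos ht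
      have hn0 : 0 < (N t).toReal := pos_of_mul_pos_right (h1.trans_le h3) hd.le
      have l2 := Real.log_le_log hn0 h2
      have l3 := Real.log_le_log h1 h3
      rw [Real.log_mul hd.ne' hn0.ne'] at l3
      have e : 2 * Real.log ((N t).toReal) / Real.log (1 / t) -
          -2 * Real.log (S t) / Real.log t =
          2 * (Real.log (S t) - Real.log ((N t).toReal)) / Real.log t := by
        rw [one_div, Real.log_inv]
        field_simp
        ring
      rw [e]
    · apply div_nonneg _ hl.le
      linarith
    · gcongr
      linarith
  refine le_antisymm (liminf_le_of_close hlim) (liminf_le_of_close ?_)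
  simpa using hlim.neg
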